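/- arXiv:1304.5164 — 7 statements merged into one kernel-verified Lean document; each statement's English description precedes it below -/
import Mathlib

section
/- Let Φ be a ℂ-linear map from n×n complex matrices to m×m complex matrices that is positivity-preserving and trace-preserving, and let ρ and σ be density matrices on ℂ^n. Then Φ(ρ) − Φ(σ) is Hermitian and ‖Φ(ρ) − Φ(σ)‖₁ ≤ ‖ρ − σ‖₁; i.e., the trace distance is monotone non-increasing under positive trace-preserving maps. -/
open Matrix ComplexOrder

/-- A Hermitian matrix is a difference of positive semidefinite matrices whose traces add up to
the sum of the absolute values of its eigenvalues. -/
theorem Matrix.IsHermitian.exists_posSemidef_sub {n : Type*} [Fintype n] [DecidableEq n]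
    {A : Matrix n n ℂ} (hA : A.IsHermitian) :
    ∃ P Q : Matrix n n ℂ, P.PosSemidef ∧ Q.PosSemidef ∧ A = P - Q ∧
      (P + Q).trace = ((∑ i, |hA.eigenvalues i| : ℝ) : ℂ) := by
  let U := (hA.eigenvectorUnitary : Matrix n n ℂ)
  have hUU : Uᴴ * U = 1 := Unitary.coe_star_mul_self hA.eigenvectorUnitary
  have hpos (f : n → ℝ) (hf : ∀ i, 0 ≤ f i) :
      (U * diagonal (fun i => (f i : ℂ)) * Uᴴ).PosSemidef :=
    (PosSemidef.diagonal fun i => Complex.zero_le_real.2 (hf i)).mul_mul_conjTranspose_same U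
  refine ⟨_, _, hpos (fun i => (hA.eigenvalues i)⁺) fun i => posPart_nonneg _,
    hpos (fun i => (hA.eigenvalues i)⁻) fun i => negPart_nonneg _, ?_, ?_⟩
  · rw [← Matrix.sub_mul, ← Matrix.mul_sub, diagonal_sub]
    simp_rw [← Complex.ofReal_sub, posPart_sub_negPart]
    exact hA.spectral_theorem
  · rw [← Matrix.add_mul, ← Matrix.mul_add, diagonal_add]
    simp_rw [← Complex.ofReal_add, posPart_add_negPart]
    rw [trace_mul_comm, ← Matrix.mul_assoc, hUU, Matrix.one_mul, trace_diagonal]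
    push_cast
    rfl

/-- The sum of the absolute values of the eigenvalues of a difference of positive semidefinite
matrices is at most the sum of their traces. -/
theorem Matrix.IsHermitian.sum_abs_eigenvalues_le {n : Type*} [Fintype n] [DecidableEq n]
    {A P Q : Matrix n n ℂ} (hA : A.IsHermitian) (hP : P.PosSemidef) (hQ : Q.PosSemidef)
    (h : A = P - Q) : ∑ i, |hA.eigenvalues i| ≤ (P + Q).trace.re := by
  let U := (hA.eigenvectorUnitary : Matrix n n ℂ)
  have hUU : U * Uᴴ = 1 := Unitary.coe_mul_star_self hA.eigenvectorUnitary
  have hdiag : Uᴴ * A * U = diagonal (fun i => (hA.eigenvalues i : ℂ)) := by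
    have := hA.conjStarAlgAut_star_eigenvectorUnitary
    rw [Unitary.conjStarAlgAut_star_apply] at this
    exact this
  have htr : (P + Q).trace = (Uᴴ * P * U + Uᴴ * Q * U).trace := by
    rw [← Matrix.add_mul, ← Matrix.mul_add, Matrix.mul_assoc, trace_mul_comm, Matrix.mul_assoc,
      hUU, Matrix.mul_one]
  rw [htr, Matrix.trace, Complex.re_sum]
  refine Finset.sum_le_sum fun i _ => ?_
  have hi : hA.eigenvalues i = ((Uᴴ * P * U) i i).re - ((Uᴴ * Q * U) i i).re := by
    have := congrArg Complex.re (congrFun (congrFun hdiag i) i)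
    rw [diagonal_apply_eq, Complex.ofReal_re] at this
    rw [← this, ← Complex.sub_re, ← Matrix.sub_apply, ← Matrix.sub_mul, ← Matrix.mul_sub, ← h]
  have hp : 0 ≤ ((Uᴴ * P * U) i i).re :=
    (Complex.le_def.1 ((hP.conjTranspose_mul_mul_same U).diag_nonneg (i := i))).1
  have hq : 0 ≤ ((Uᴴ * Q * U) i i).re :=
    (Complex.le_def.1 ((hQ.conjTranspose_mul_mul_same U).diag_nonneg (i := i))).1
  rw [hi, diag_apply, Matrix.add_apply, Complex.add_re, abs_le]
  constructor <;> linarith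

/-- The trace distance is monotone non-increasing under positive trace-preserving
linear maps. -/
theorem trace_distance_monotone {n m : ℕ}
    (Φ : Matrix (Fin n) (Fin n) ℂ →ₗ[ℂ] Matrix (Fin m) (Fin m) ℂ)
    (hΦpos : ∀ A : Matrix (Fin n) (Fin n) ℂ, A.PosSemidef → (Φ A).PosSemidef)
    (hΦtr : ∀ A : Matrix (Fin n) (Fin n) ℂ, (Φ A).trace = A.trace)
    (ρ σ : Matrix (Fin n) (Fin n) ℂ)
    (hρ : ρ.PosSemidef) (hσ : σ.PosSemidef)
    (hρtr : ρ.trace = 1) (hσtr : σ.trace = 1) :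
    ∃ h : (Φ ρ - Φ σ).IsHermitian,
      ∑ i, |h.eigenvalues i| ≤ ∑ i, |(hρ.isHermitian.sub hσ.isHermitian).eigenvalues i| := by
  refine ⟨(hΦpos ρ hρ).isHermitian.sub (hΦpos σ hσ).isHermitian, ?_⟩
  obtain ⟨P, Q, hP, hQ, hsub, htr⟩ := (hρ.isHermitian.sub hσ.isHermitian).exists_posSemidef_sub
  refine (IsHermitian.sum_abs_eigenvalues_le _ (hΦpos P hP) (hΦpos Q hQ) ?_).trans_eq ?_
  · rw [← map_sub, hsub, map_sub]
  · rw [← map_add, hΦtr, htr, Complex.ofReal_re]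
end

section
/- (Fact 1.) Let Φ be a ℂ-linear map from 2×2 complex matrices to 2×2 complex matrices that is positivity-preserving and trace-preserving, and let ρ and σ be 2×2 density matrices. If ‖Φ(ρ) − Φ(σ)‖₁ = 2, then ρ and σ are pure and orthogonal: there exist unit vectors v, w ∈ ℂ² with ⟨v, w⟩ = 0 such that ρ = v vᴴ and σ = w wᴴ. -/
open Matrix ComplexOrder

namespace Matrix

lemma det_add_add_det_sub_fin_two {R : Type*} [CommRing R] (A B : Matrix (Fin 2) (Fin 2) R) :
    (A + B).det + (A - B).det = 2 * A.det + 2 * B.det := by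
  simp only [det_fin_two, add_apply, sub_apply]
  ring

lemma IsHermitian.exists_eq_fin_two {A : Matrix (Fin 2) (Fin 2) ℂ} (hA : A.IsHermitian) :
    ∃ a x y d : ℝ, A = !![(a : ℂ), ⟨x, y⟩; ⟨x, -y⟩, (d : ℂ)] := by
  refine ⟨(A 0 0).re, (A 0 1).re, (A 0 1).im, (A 1 1).re, ?_⟩
  have h00 := congrArg Complex.im (hA.apply 0 0)
  have h11 := congrArg Complex.im (hA.apply 1 1)
  have h10 := hA.apply 1 0
  simp only [Complex.star_def, Complex.conj_im] at h00 h11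
  ext i j
  fin_cases i <;> fin_cases j <;> apply Complex.ext <;> simp [← h10] <;> linarith

lemma IsHermitian.re_det_le_of_trace_eq_two {A : Matrix (Fin 2) (Fin 2) ℂ} (hA : A.IsHermitian)
    (htr : A.trace = 2) : A.det.re ≤ 1 := by
  obtain ⟨a, x, y, d, rfl⟩ := hA.exists_eq_fin_two
  have h : a + d = 2 := by simpa [trace_fin_two] using congrArg Complex.re htr
  simp only [det_fin_two_of, Complex.sub_re, Complex.mul_re, Complex.ofReal_re, Complex.ofReal_im]
  obtain rfl : d = 2 - a := by linarith
  nlinarith [sq_nonneg (a - 1), sq_nonneg x, sq_nonneg y]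

lemma IsHermitian.eq_one_of_trace_eq_two_of_le_re_det {A : Matrix (Fin 2) (Fin 2) ℂ}
    (hA : A.IsHermitian) (htr : A.trace = 2) (hdet : 1 ≤ A.det.re) : A = 1 := by
  obtain ⟨a, x, y, d, rfl⟩ := hA.exists_eq_fin_two
  have h : a + d = 2 := by simpa [trace_fin_two] using congrArg Complex.re htr
  simp only [det_fin_two_of, Complex.sub_re, Complex.mul_re, Complex.ofReal_re,
    Complex.ofReal_im] at hdet
  obtain rfl : d = 2 - a := by linarith
  have ha : a - 1 = 0 := by
    apply pow_eq_zero_iff (two_ne_zero) |>.mp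
    nlinarith [sq_nonneg (a - 1), sq_nonneg x, sq_nonneg y]
  have hx : x = 0 := by
    apply pow_eq_zero_iff (two_ne_zero) |>.mp
    nlinarith [sq_nonneg (a - 1), sq_nonneg x, sq_nonneg y]
  have hy : y = 0 := by
    apply pow_eq_zero_iff (two_ne_zero) |>.mp
    nlinarith [sq_nonneg (a - 1), sq_nonneg x, sq_nonneg y]
  obtain rfl : a = 1 := by linarith
  subst hx hy
  ext i j
  fin_cases i <;> fin_cases j <;> apply Complex.ext <;> simp
  all_goals norm_num

lemma IsHermitian.posSemidef_of_trace_nonneg_of_det_nonneg {A : Matrix (Fin 2) (Fin 2) ℂ}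
    (hA : A.IsHermitian) (htr : 0 ≤ A.trace.re) (hdet : 0 ≤ A.det.re) : A.PosSemidef := by
  rw [hA.posSemidef_iff_eigenvalues_nonneg]
  rw [hA.trace_eq_sum_eigenvalues] at htr
  rw [hA.det_eq_prod_eigenvalues] at hdet
  simp only [Fin.sum_univ_two, Fin.prod_univ_two] at htr hdet
  simp only [← RCLike.ofReal_add, ← RCLike.ofReal_mul] at htr hdet
  change 0 ≤ hA.eigenvalues 0 + hA.eigenvalues 1 at htr
  change 0 ≤ hA.eigenvalues 0 * hA.eigenvalues 1 at hdet
  have h0 : 0 ≤ hA.eigenvalues 0 := by by_contra! h; nlinarith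
  have h1 : 0 ≤ hA.eigenvalues 1 := by by_contra! h; nlinarith
  intro i
  fin_cases i
  exacts [h0, h1]

/-- A traceless Hermitian `2 × 2` matrix of trace norm `2` has determinant `-1`. -/
lemma IsHermitian.det_eq_neg_one_of_sum_abs_eigenvalues_eq_two {A : Matrix (Fin 2) (Fin 2) ℂ}
    (hA : A.IsHermitian) (htr : A.trace = 0) (h : ∑ i, |hA.eigenvalues i| = 2) :
    A.det = -1 := by
  rw [hA.trace_eq_sum_eigenvalues] at htr
  rw [hA.det_eq_prod_eigenvalues]
  simp only [Fin.sum_univ_two, Fin.prod_univ_two] at htr h ⊢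
  rw [← RCLike.ofReal_add, RCLike.ofReal_eq_zero] at htr
  have h1 : hA.eigenvalues 1 = -hA.eigenvalues 0 := by linarith
  rw [h1, abs_neg] at h
  have h2 : hA.eigenvalues 0 ^ 2 = 1 := by
    rw [← sq_abs, show |hA.eigenvalues 0| = 1 by linarith, one_pow]
  rw [h1, ← RCLike.ofReal_mul, show hA.eigenvalues 0 * -hA.eigenvalues 0 = -1 by linarith]
  simp

/-- Positive trace-preserving maps contract the trace norm of traceless Hermitian matrices; in
dimension two this is a comparison of determinants. -/
lemma re_det_le_neg_one_of_map {Φ : Matrix (Fin 2) (Fin 2) ℂ →ₗ[ℂ] Matrix (Fin 2) (Fin 2) ℂ}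
    (hΦpos : ∀ A : Matrix (Fin 2) (Fin 2) ℂ, A.PosSemidef → (Φ A).PosSemidef)
    (hΦtr : ∀ A : Matrix (Fin 2) (Fin 2) ℂ, (Φ A).trace = A.trace)
    {A : Matrix (Fin 2) (Fin 2) ℂ} (hA : A.IsHermitian) (htr : A.trace = 0)
    (hdet : (Φ A).det = -1) : A.det.re ≤ -1 := by
  set m : ℝ := Real.sqrt (-A.det.re)
  have hA0 : 0 ≤ -A.det.re := by
    obtain ⟨a, x, y, d, rfl⟩ := hA.exists_eq_fin_two
    have h : a + d = 0 := by simpa [trace_fin_two] using congrArg Complex.re htr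
    simp only [det_fin_two_of, Complex.sub_re, Complex.mul_re, Complex.ofReal_re,
      Complex.ofReal_im]
    obtain rfl : d = -a := by linarith
    nlinarith [sq_nonneg a, sq_nonneg x, sq_nonneg y]
  have hm0 : 0 ≤ m := Real.sqrt_nonneg _
  have hm : m ^ 2 = -A.det.re := Real.sq_sqrt hA0
  have key : ∀ B : Matrix (Fin 2) (Fin 2) ℂ, B.IsHermitian → B.trace = 0 → B.det = A.det →
      ((m : ℂ) • (1 : Matrix (Fin 2) (Fin 2) ℂ) + B).PosSemidef := by
    intro B hB hBtr hBdet
    have hH : ((m : ℂ) • (1 : Matrix (Fin 2) (Fin 2) ℂ)).IsHermitian := by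
      simp [IsHermitian, conjTranspose_smul]
    refine (hH.add hB).posSemidef_of_trace_nonneg_of_det_nonneg ?_ ?_
    · simp [trace_add, hBtr, trace_smul, hm0]
    · have h : ((m : ℂ) • (1 : Matrix (Fin 2) (Fin 2) ℂ) + B).det
          = (m : ℂ) ^ 2 + m * B.trace + B.det := by
        simp [det_fin_two, trace_fin_two]
        ring
      rw [h, hBtr, hBdet]
      have : ((m : ℂ) ^ 2 + m * 0 + A.det).re = m ^ 2 + A.det.re := by
        simp [← Complex.ofReal_pow]
      rw [this]
      linarith
  have hp := (Complex.le_def.mp (hΦpos _ (key A hA htr rfl)).det_nonneg).1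
  have hn := (Complex.le_def.mp (hΦpos _ (key (-A) hA.neg (by simp [htr])
    (by simp [det_neg]))).det_nonneg).1
  have hone := (hΦpos 1 PosSemidef.one).isHermitian.re_det_le_of_trace_eq_two
    (by simp [hΦtr])
  have hsum := congrArg Complex.re
    (det_add_add_det_sub_fin_two ((m : ℂ) • Φ 1) (Φ A))
  simp only [map_add, map_neg, map_smul] at hp hn
  rw [← sub_eq_add_neg] at hn
  have hs : (2 * ((m : ℂ) • Φ 1).det + 2 * (Φ A).det).re = 2 * (m ^ 2 * (Φ 1).det.re) - 2 := by
    rw [det_smul, hdet]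
    simp [← Complex.ofReal_pow]
    ring
  rw [hs, Complex.add_re] at hsum
  simp only [Complex.zero_re] at hp hn
  nlinarith [sq_nonneg m]

lemma IsHermitian.exists_orthonormal_eq_vecMulVec {A : Matrix (Fin 2) (Fin 2) ℂ}
    (hA : A.IsHermitian) (htr : A.trace = 1) (hdet : A.det = 0) :
    ∃ v w : Fin 2 → ℂ,
      star v ⬝ᵥ v = 1 ∧ star w ⬝ᵥ w = 1 ∧ star v ⬝ᵥ w = 0 ∧
      A = vecMulVec v (star v) ∧ 1 - A = vecMulVec w (star w) := by
  obtain ⟨a, x, y, d, rfl⟩ := hA.exists_eq_fin_two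
  have h : a + d = 1 := by simpa [trace_fin_two] using congrArg Complex.re htr
  have hd := congrArg Complex.re hdet
  simp only [det_fin_two_of, Complex.sub_re, Complex.mul_re, Complex.ofReal_re,
    Complex.ofReal_im, Complex.zero_re] at hd
  obtain rfl : d = 1 - a := by linarith
  have hxy : x ^ 2 + y ^ 2 = a * (1 - a) := by linarith
  have ha : 0 ≤ a := by nlinarith [sq_nonneg x, sq_nonneg y, sq_nonneg a]
  rcases ha.eq_or_lt with rfl | ha
  · have hx : x = 0 := by nlinarith [sq_nonneg x, sq_nonneg y]
    have hy : y = 0 := by nlinarith [sq_nonneg x, sq_nonneg y]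
    subst hx hy
    refine ⟨![0, 1], ![1, 0], by simp [dotProduct], by simp [dotProduct], by simp [dotProduct],
      ?_, ?_⟩ <;> ext i j <;> fin_cases i <;> fin_cases j <;> apply Complex.ext <;>
      simp [vecMulVec_apply]
  · obtain ⟨s, hs, rfl⟩ : ∃ s : ℝ, 0 < s ∧ s ^ 2 = a :=
      ⟨√a, Real.sqrt_pos.mpr ha, Real.sq_sqrt ha.le⟩
    obtain ⟨p, rfl⟩ : ∃ p, x = s * p := ⟨x / s, by field_simp⟩
    obtain ⟨q, rfl⟩ : ∃ q, y = s * q := ⟨y / s, by field_simp⟩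
    have hpq : p ^ 2 + q ^ 2 = 1 - s ^ 2 := by
      have : s ^ 2 ≠ 0 := by positivity
      apply mul_left_cancel₀ this
      linarith
    refine ⟨![s, ⟨p, -q⟩], ![⟨-p, -q⟩, s], ?_, ?_, ?_, ?_, ?_⟩
    · apply Complex.ext <;> simp [dotProduct] <;> linarith
    · apply Complex.ext <;> simp [dotProduct] <;> linarith
    · apply Complex.ext <;> simp [dotProduct] <;> ring
    all_goals
      ext i j
      fin_cases i <;> fin_cases j <;> apply Complex.ext <;>
        simp [vecMulVec_apply, -Complex.ofReal_pow] <;> linarith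

end Matrix

/-- Fact 1: if a positive trace-preserving map sends two 2×2 density matrices to states at
maximal trace distance 2, then the inputs are pure and orthogonal. -/
theorem pure_orthogonal_of_channel_output_distance_eq_two
    (Φ : Matrix (Fin 2) (Fin 2) ℂ →ₗ[ℂ] Matrix (Fin 2) (Fin 2) ℂ)
    (hΦpos : ∀ A : Matrix (Fin 2) (Fin 2) ℂ, A.PosSemidef → (Φ A).PosSemidef)
    (hΦtr : ∀ A : Matrix (Fin 2) (Fin 2) ℂ, (Φ A).trace = A.trace)
    (ρ σ : Matrix (Fin 2) (Fin 2) ℂ)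
    (hρ : ρ.PosSemidef) (hσ : σ.PosSemidef)
    (hρtr : ρ.trace = 1) (hσtr : σ.trace = 1)
    (hherm : (Φ ρ - Φ σ).IsHermitian)
    (hdist : ∑ i, |hherm.eigenvalues i| = 2) :
    ∃ v w : Fin 2 → ℂ,
      star v ⬝ᵥ v = 1 ∧ star w ⬝ᵥ w = 1 ∧ star v ⬝ᵥ w = 0 ∧
      ρ = vecMulVec v (star v) ∧ σ = vecMulVec w (star w) := by
  have hδtr : (ρ - σ).trace = 0 := by simp [trace_sub, hρtr, hσtr]
  have hΦdet : (Φ (ρ - σ)).det = -1 := by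
    rw [map_sub]
    exact hherm.det_eq_neg_one_of_sum_abs_eigenvalues_eq_two
      (by simp [trace_sub, hΦtr, hρtr, hσtr]) hdist
  have hdet := re_det_le_neg_one_of_map hΦpos hΦtr
    (hρ.isHermitian.sub hσ.isHermitian) hδtr hΦdet
  have hsumH := hρ.isHermitian.add hσ.isHermitian
  have hsumtr : (ρ + σ).trace = 2 := by
    rw [trace_add, hρtr, hσtr]
    norm_num
  have hle := hsumH.re_det_le_of_trace_eq_two hsumtr
  have hpar := congrArg Complex.re (det_add_add_det_sub_fin_two ρ σ)
  have hρ0 := Complex.le_def.mp hρ.det_nonneg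
  have hσ0 := Complex.le_def.mp hσ.det_nonneg
  simp only [Complex.add_re, Complex.mul_re, Complex.re_ofNat, Complex.im_ofNat, zero_mul,
    sub_zero] at hpar
  simp only [Complex.zero_re, Complex.zero_im] at hρ0 hσ0
  have hone := hsumH.eq_one_of_trace_eq_two_of_le_re_det hsumtr (by linarith)
  have hρdet : ρ.det = 0 := Complex.ext (by simp only [Complex.zero_re]; linarith) hρ0.2.symm
  rw [eq_sub_of_add_eq' hone]
  exact hρ.isHermitian.exists_orthonormal_eq_vecMulVec hρtr hρdet
end

section
/- (Output of the traced-out Toffoli channel, Eq. (1).) Let m ≥ 2 and index (2^m)-dimensional matrices by pairs (x, j) with x : Fin (m−1) → Fin 2 and j : Fin 2. Let T be the m-qubit Toffoli permutation matrix with the last qubit as target: T((x,j),(y,k)) = 1 if y = x and k = j + (1 if x i = 1 for all i, else 0) (mod 2), and 0 otherwise. Let ρ₁, …, ρ_{m−1} and ρ_m be 2×2 density matrices, and let ρ be the product state given entrywise by ρ((x,j),(y,k)) = (∏_{i} ρᵢ(x i, y i)) · ρ_m(j,k). Set a = ∏_{i} ρᵢ(1,1). Then the partial trace over the first m−1 qubits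 of T ρ Tᴴ equals a·(X ρ_m X) + (1−a)·ρ_m; explicitly, for all j, k ∈ Fin 2, ∑_{x : Fin (m−1) → Fin 2} (T ρ Tᴴ)((x,j),(x,k)) = (a·(X ρ_m X) + (1−a)·ρ_m)(j,k). -/
open Matrix ComplexOrder

/-- The Pauli X matrix. -/
noncomputable def PauliX : Matrix (Fin 2) (Fin 2) ℂ := !![0, 1; 1, 0]

/-- Conjugating by the 0-1 matrix of a function `f` reindexes the entries along `f`. -/
theorem mul_mul_conjTranspose_apply_of_function {n R : Type*} [Fintype n] [DecidableEq n]
    [CommSemiring R] [StarRing R] (f : n → n) {M : Matrix n n R}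
    (hM : ∀ p q, M p q = if q = f p then 1 else 0) (A : Matrix n n R) (p q : n) :
    (M * A * Mᴴ) p q = A (f p) (f q) := by
  simp [Matrix.mul_apply, hM, apply_ite (star : R → R)]

theorem pauliX_mul_mul_pauliX_apply (A : Matrix (Fin 2) (Fin 2) ℂ) (j k : Fin 2) :
    (PauliX * A * PauliX) j k = A (j + 1) (k + 1) := by
  fin_cases j <;> fin_cases k <;>
    simp [PauliX, Matrix.mul_apply, Matrix.vecMul, dotProduct, Fin.sum_univ_two]

/-- The diagonal entries of a tensor product of trace-one matrices sum to one. -/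
theorem sum_prod_diag_eq_one {ι n R : Type*} [Fintype ι] [DecidableEq ι] [Fintype n]
    [CommSemiring R] (A : ι → Matrix n n R) (hA : ∀ i, (A i).trace = 1) :
    ∑ x : ι → n, ∏ i, A i (x i) (x i) = 1 := by
  rw [← Fintype.prod_sum fun i j => A i j j]
  exact Finset.prod_eq_one fun i _ => hA i

/-- Eq. (1): the partial trace over the control qubits of the Toffoli gate applied to a
product state `ρ₁ ⊗ ⋯ ⊗ ρ_{m-1} ⊗ ρ_m` equals `a • (X ρ_m X) + (1-a) • ρ_m`, where
`a = ∏ i, ρᵢ 1 1`. -/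
theorem toffoli_partial_trace (m : ℕ) (hm : 2 ≤ m)
    (T : Matrix ((Fin (m - 1) → Fin 2) × Fin 2) ((Fin (m - 1) → Fin 2) × Fin 2) ℂ)
    (hT : ∀ p q : (Fin (m - 1) → Fin 2) × Fin 2,
      T p q = if q.1 = p.1 ∧ q.2 = p.2 + (if ∀ i, p.1 i = 1 then 1 else 0) then 1 else 0)
    (ρs : Fin (m - 1) → Matrix (Fin 2) (Fin 2) ℂ)
    (hρs : ∀ i, (ρs i).PosSemidef ∧ (ρs i).trace = 1)
    (ρm : Matrix (Fin 2) (Fin 2) ℂ)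
    (hρm : ρm.PosSemidef ∧ ρm.trace = 1)
    (ρ : Matrix ((Fin (m - 1) → Fin 2) × Fin 2) ((Fin (m - 1) → Fin 2) × Fin 2) ℂ)
    (hρ : ∀ p q : (Fin (m - 1) → Fin 2) × Fin 2,
      ρ p q = (∏ i, ρs i (p.1 i) (q.1 i)) * ρm p.2 q.2)
    (a : ℂ) (ha : a = ∏ i, ρs i 1 1) :
    ∀ j k : Fin 2,
      ∑ x : Fin (m - 1) → Fin 2, (T * ρ * Tᴴ) ((x, j)) ((x, k)) =
        (a • (PauliX * ρm * PauliX) + (1 - a) • ρm) j k := by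
  intro j k
  let c : (Fin (m - 1) → Fin 2) → Fin 2 := fun x => if ∀ i, x i = 1 then 1 else 0
  have hT' : ∀ p q, T p q = if q = (p.1, p.2 + c p.1) then 1 else 0 := fun p q => by
    simp only [hT, Prod.ext_iff, c]
  have hterm : ∀ x : Fin (m - 1) → Fin 2, (T * ρ * Tᴴ) (x, j) (x, k) =
      (∏ i, ρs i (x i) (x i)) * ρm j k +
        if x = 1 then (∏ i, ρs i (x i) (x i)) * (ρm (j + 1) (k + 1) - ρm j k) else 0 := by
    intro x
    rw [mul_mul_conjTranspose_apply_of_function (fun p => (p.1, p.2 + c p.1)) hT', hρ]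
    by_cases hx : x = 1
    · subst hx
      simp [c]
      ring
    · have hx' : ¬ ∀ i, x i = 1 := fun h => hx (funext h)
      simp [c, hx, hx']
  simp only [hterm, Finset.sum_add_distrib, ← Finset.sum_mul,
    sum_prod_diag_eq_one ρs fun i => (hρs i).2, Finset.sum_ite_eq', Finset.mem_univ, if_true,
    Pi.one_apply, ← ha, Matrix.add_apply, Matrix.smul_apply, pauliX_mul_mul_pauliX_apply,
    smul_eq_mul]
  ring
end

section
/- (Theorem 3, dequantization of the depth-one Toffoli formula.) Let m ≥ 2. Index (2^m)-dimensional matrices by pairs (x, j) with x : Fin (m−1) → Fin 2, j : Fin 2, and let T be the m-qubit Toffoli permutation matrix with the last qubit as target: T((x,j),(y,k)) = 1 if y = x and k = j + (1 if x i = 1 for all i, else 0) (mod 2), and 0 otherwise. For each i let rᵢ : Bool → (2×2 density matrices) be arbitrary, let r_t : Bool → (2×2 density matrices) be arbitrary, and let Ψ be a ℂ-linear, positivity-preserving, trace-preserving map on 2×2 complex matrices. For an input u : Fin (m−1) → Bool and v : Bool, let ρ(u,v) be the product state with entries ρ(u,v)((x,j),(y,k)) = (∏_i rᵢ(u i)(x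 i, y i)) · r_t(v)(j,k), and let PT(u,v) be the 2×2 matrix whose (j,k) entry is ∑_x (T ρ(u,v) Tᴴ)((x,j),(x,k)) (the partial trace over the control qubits). Suppose there is a function f : ((Fin (m−1) → Bool) × Bool) → Bool such that for all inputs (u,v), Ψ(PT(u,v)) equals the rank-one matrix e_{f(u,v)} e_{f(u,v)}ᴴ (where e_false, e_true are the standard basis vectors of ℂ²). Then f is obtained from the classical Toffoli by single-bit pre- and post-processing: there exist functions g : Fin (m−1) → (Bool → Bool), g_t : Bool → Bool, and h : Bool → Bool such that for all (u,v), f(u,v) = h( (⋀_i g i (u i)) XOR g_t(v) ). -/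
open Matrix ComplexOrder

/-- Standard basis vectors of ℂ², indexed by a Boolean. -/
def ebasis (b : Bool) : Fin 2 → ℂ := fun j => if j = (if b then 1 else 0) then 1 else 0

/-- The Pauli `X` matrix. -/
def pauliX : Matrix (Fin 2) (Fin 2) ℂ := !![0, 1; 1, 0]

lemma pauliX_conjTranspose : pauliXᴴ = pauliX := by
  ext i j
  fin_cases i <;> fin_cases j <;> simp [pauliX]

lemma pauliX_mul_apply (A : Matrix (Fin 2) (Fin 2) ℂ) (j k : Fin 2) :
    (pauliX * A) j k = A (j + 1) k := by
  rw [Matrix.mul_apply, Fin.sum_univ_two]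
  fin_cases j <;> simp [pauliX]

lemma mul_pauliX_apply (A : Matrix (Fin 2) (Fin 2) ℂ) (j k : Fin 2) :
    (A * pauliX) j k = A j (k + 1) := by
  rw [Matrix.mul_apply, Fin.sum_univ_two]
  fin_cases k <;> simp [pauliX]

lemma pauliX_conj_apply (A : Matrix (Fin 2) (Fin 2) ℂ) (j k : Fin 2) :
    (pauliX * A * pauliX) j k = A (j + 1) (k + 1) := by
  rw [mul_pauliX_apply, pauliX_mul_apply]

lemma pauliX_conj_conj (A : Matrix (Fin 2) (Fin 2) ℂ) :
    pauliX * (pauliX * A * pauliX) * pauliX = A := by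
  ext j k
  rw [pauliX_conj_apply, pauliX_conj_apply]
  fin_cases j <;> fin_cases k <;> rfl

lemma trace_pauliX_conj (A : Matrix (Fin 2) (Fin 2) ℂ) :
    (pauliX * A * pauliX).trace = A.trace := by
  simp only [Matrix.trace_fin_two, pauliX_conj_apply]
  exact add_comm _ _

lemma posSemidef_pauliX_conj {A : Matrix (Fin 2) (Fin 2) ℂ} (hA : A.PosSemidef) :
    (pauliX * A * pauliX).PosSemidef := by
  simpa only [pauliX_conjTranspose] using hA.mul_mul_conjTranspose_same pauliX

lemma add_pauliX_conj {A : Matrix (Fin 2) (Fin 2) ℂ} (hA : A.IsHermitian) (ht : A.trace = 1) :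
    A + pauliX * A * pauliX = 1 + (2 * (A 0 1).re) • pauliX := by
  have h10 : A 1 0 = star (A 0 1) := (hA.apply 1 0).symm
  rw [Matrix.trace_fin_two] at ht
  have hs : A 0 1 + star (A 0 1) = ((2 * (A 0 1).re : ℝ) : ℂ) := Complex.add_conj _
  ext j k
  rw [Matrix.add_apply, pauliX_conj_apply]
  fin_cases j <;> fin_cases k <;>
    simp [pauliX, h10] at ht hs ⊢ <;>
    first
    | linear_combination ht
    | linear_combination hs

lemma pauliX_anticomm {A : Matrix (Fin 2) (Fin 2) ℂ} (hA : A.IsHermitian) (ht : A.trace = 1) :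
    pauliX * A + A * pauliX = pauliX + (2 * (A 0 1).re) • (1 : Matrix (Fin 2) (Fin 2) ℂ) := by
  have h10 : A 1 0 = star (A 0 1) := (hA.apply 1 0).symm
  rw [Matrix.trace_fin_two] at ht
  have hs : A 0 1 + star (A 0 1) = ((2 * (A 0 1).re : ℝ) : ℂ) := Complex.add_conj _
  ext j k
  rw [Matrix.add_apply, pauliX_mul_apply, mul_pauliX_apply]
  fin_cases j <;> fin_cases k <;>
    simp [pauliX, h10] at ht hs ⊢ <;>
    first
    | linear_combination ht
    | linear_combination hs

/-- If an effect (a real functional between `0` and the trace on positive semidefinite matrices)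
perfectly distinguishes a state from its bit flip, then it sends the bit flip of any state to the
complementary probability. -/
lemma effect_add_flip (φ : Matrix (Fin 2) (Fin 2) ℂ →ₗ[ℝ] ℝ)
    (hpos : ∀ A, A.PosSemidef → 0 ≤ φ A) (hle : ∀ A, A.PosSemidef → φ A ≤ A.trace.re)
    {σ : Matrix (Fin 2) (Fin 2) ℂ} (hσ : σ.PosSemidef) (hσt : σ.trace = 1)
    (h0 : φ σ = 0) (h1 : φ (pauliX * σ * pauliX) = 1)
    {τ : Matrix (Fin 2) (Fin 2) ℂ} (hτ : τ.PosSemidef) (hτt : τ.trace = 1) :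
    φ τ + φ (pauliX * τ * pauliX) = 1 := by
  set s : ℝ := 2 * (σ 0 1).re
  have hanti : pauliX * σ + σ * pauliX = pauliX + s • (1 : Matrix (Fin 2) (Fin 2) ℂ) :=
    pauliX_anticomm hσ.isHermitian hσt
  have hexp (k : ℝ) : (1 + k • pauliX) * σ * (1 + k • pauliX)ᴴ
      = σ + k • (pauliX + s • (1 : Matrix (Fin 2) (Fin 2) ℂ))
        + (k ^ 2) • (pauliX * σ * pauliX) := by
    have hk : (1 + k • pauliX)ᴴ = 1 + k • pauliX := by
      simp [Matrix.conjTranspose_smul, pauliX_conjTranspose]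
    rw [hk, ← hanti]
    simp only [add_mul, mul_add, one_mul, mul_one, smul_mul_assoc, mul_smul_comm, smul_add,
      smul_smul, pow_two]
    abel
  have hpsd (k : ℝ) := hσ.mul_mul_conjTranspose_same (1 + k • pauliX)
  set c : ℝ := φ (pauliX + s • (1 : Matrix (Fin 2) (Fin 2) ℂ)) with hc
  have hlow (k : ℝ) : 0 ≤ k * c + k ^ 2 := by
    have := hpos _ (hpsd k)
    rw [hexp, map_add, map_add, map_smul, map_smul, h0, h1, ← hc] at this
    simpa using this
  have hc0 : c = 0 := by
    have := hlow (-c / 2)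
    nlinarith [sq_nonneg c]
  have hup (k : ℝ) : 0 ≤ 1 + 2 * k * s := by
    have := hle _ (hpsd k)
    rw [hexp, map_add, map_add, map_smul, map_smul, h0, h1, ← hc, hc0] at this
    have hX : pauliX.trace = 0 := by simp [pauliX, Matrix.trace_fin_two]
    simp only [Matrix.trace_add, Matrix.trace_smul, trace_pauliX_conj, hσt, hX] at this
    simp [-Complex.ofReal_pow] at this
    linarith
  have hs0 : s = 0 := by
    have := hup (-s)
    by_contra hne
    have h2 := hup (-1 / s)
    have : 2 * (-1 / s) * s = -2 := by field_simp
    linarith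
  have hX0 : φ pauliX = 0 := by
    rw [hs0, zero_smul, add_zero] at hc
    rw [← hc, hc0]
  have hone : φ 1 = 1 := by
    have := congrArg φ (add_pauliX_conj hσ.isHermitian hσt)
    rw [map_add, map_add, map_smul, h0, h1, hX0] at this
    simpa using this.symm
  rw [← map_add, add_pauliX_conj hτ.isHermitian hτt, map_add, map_smul, hX0, hone]
  simp

lemma diag_re_mem_Icc {A : Matrix (Fin 2) (Fin 2) ℂ} (hA : A.PosSemidef) :
    0 ≤ (A 1 1).re ∧ (A 1 1).re ≤ A.trace.re := by
  have h (i : Fin 2) : 0 ≤ (A i i).re := (Complex.le_def.1 (hA.diag_nonneg (i := i))).1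
  refine ⟨h 1, ?_⟩
  rw [Matrix.trace_fin_two, Complex.add_re]
  linarith [h 0]

/-- Partial trace over the controls after a Toffoli gate on a product state: the target is flipped
with the probability that all controls are `1`. -/
lemma sum_toffoli_conj {ι : Type*} [Fintype ι] [DecidableEq ι]
    [∀ x : ι → Fin 2, Decidable (∀ i, x i = 1)]
    {T ρ : Matrix ((ι → Fin 2) × Fin 2) ((ι → Fin 2) × Fin 2) ℂ}
    (hT : ∀ p q : (ι → Fin 2) × Fin 2,
      T p q = if q.1 = p.1 ∧ q.2 = p.2 + (if ∀ i, p.1 i = 1 then 1 else 0) then 1 else 0)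
    {s : ι → Matrix (Fin 2) (Fin 2) ℂ} {σ : Matrix (Fin 2) (Fin 2) ℂ}
    (hs : ∀ i, (s i).PosSemidef ∧ (s i).trace = 1)
    (hρ : ∀ p q, ρ p q = (∏ i, s i (p.1 i) (q.1 i)) * σ p.2 q.2) (j k : Fin 2) :
    ∑ x : ι → Fin 2, (T * ρ * Tᴴ) (x, j) (x, k)
      = ((1 - ∏ i, (s i 1 1).re) • σ + (∏ i, (s i 1 1).re) • (pauliX * σ * pauliX)) j k := by
  have hT' (p q : (ι → Fin 2) × Fin 2) :
      T p q = if q = (p.1, p.2 + (if ∀ i, p.1 i = 1 then 1 else 0)) then 1 else 0 := by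
    rw [hT]
    simp only [Prod.ext_iff]
  have hentry (x : ι → Fin 2) : (T * ρ * Tᴴ) (x, j) (x, k)
      = (∏ i, s i (x i) (x i)) * σ j k
        + if x = 1 then (∏ i, s i 1 1) * (σ (j + 1) (k + 1) - σ j k) else 0 := by
    have h1 : (T * ρ * Tᴴ) (x, j) (x, k)
        = ρ (x, j + (if ∀ i, x i = 1 then 1 else 0)) (x, k + (if ∀ i, x i = 1 then 1 else 0)) := by
      simp only [Matrix.mul_apply, Matrix.conjTranspose_apply, hT']
      generalize (if ∀ i, x i = 1 then (1 : Fin 2) else 0) = a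
      simp only [ite_mul, one_mul, zero_mul, Finset.sum_ite_eq', Finset.mem_univ, if_true,
        RCLike.star_def, apply_ite (starRingEnd ℂ), map_one, map_zero, mul_ite, mul_one, mul_zero]
    have hx : (∀ i, x i = 1) ↔ x = 1 := by simp [funext_iff]
    rw [h1, hρ]
    simp only [hx]
    split_ifs with h
    · subst h
      simp only [Pi.one_apply]
      ring
    · simp
  have hreal (i : ι) : (((s i 1 1).re : ℝ) : ℂ) = s i 1 1 := by
    have h := (hs i).1.isHermitian.apply 1 1
    exact Complex.conj_eq_iff_re.1 h
  have hsum : ∑ x : ι → Fin 2, ∏ i, s i (x i) (x i) = 1 := by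
    rw [← Fintype.prod_sum (fun i a => s i a a)]
    exact Finset.prod_eq_one fun i _ => (hs i).2
  simp only [hentry, Finset.sum_add_distrib, ← Finset.sum_mul, hsum, Finset.sum_ite_eq',
    Finset.mem_univ, if_true]
  simp only [Matrix.add_apply, Matrix.smul_apply, pauliX_conj_apply, Complex.real_smul]
  push_cast
  simp only [hreal]
  ring

/-- Theorem 3: any classical function obtained from the traced-out Toffoli channel by
placing single-qubit channels before and after it is the classical Toffoli up to
single-bit pre- and post-processing. -/
theorem toffoli_depth_one_dequantization (m : ℕ) (hm : 2 ≤ m)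
    (T : Matrix ((Fin (m - 1) → Fin 2) × Fin 2) ((Fin (m - 1) → Fin 2) × Fin 2) ℂ)
    (hT : ∀ p q : (Fin (m - 1) → Fin 2) × Fin 2,
      T p q = if q.1 = p.1 ∧ q.2 = p.2 + (if ∀ i, p.1 i = 1 then 1 else 0) then 1 else 0)
    (r : Fin (m - 1) → Bool → Matrix (Fin 2) (Fin 2) ℂ)
    (hr : ∀ i b, (r i b).PosSemidef ∧ (r i b).trace = 1)
    (rt : Bool → Matrix (Fin 2) (Fin 2) ℂ)
    (hrt : ∀ b, (rt b).PosSemidef ∧ (rt b).trace = 1)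
    (Ψ : Matrix (Fin 2) (Fin 2) ℂ →ₗ[ℂ] Matrix (Fin 2) (Fin 2) ℂ)
    (hΨpos : ∀ A : Matrix (Fin 2) (Fin 2) ℂ, A.PosSemidef → (Ψ A).PosSemidef)
    (hΨtr : ∀ A : Matrix (Fin 2) (Fin 2) ℂ, (Ψ A).trace = A.trace)
    (ρ : (Fin (m - 1) → Bool) → Bool →
      Matrix ((Fin (m - 1) → Fin 2) × Fin 2) ((Fin (m - 1) → Fin 2) × Fin 2) ℂ)
    (hρ : ∀ (u : Fin (m - 1) → Bool) (v : Bool) (p q : (Fin (m - 1) → Fin 2) × Fin 2),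
      ρ u v p q = (∏ i, r i (u i) (p.1 i) (q.1 i)) * rt v p.2 q.2)
    (PT : (Fin (m - 1) → Bool) → Bool → Matrix (Fin 2) (Fin 2) ℂ)
    (hPT : ∀ (u : Fin (m - 1) → Bool) (v : Bool) (j k : Fin 2),
      PT u v j k = ∑ x : Fin (m - 1) → Fin 2, (T * ρ u v * Tᴴ) ((x, j)) ((x, k)))
    (f : ((Fin (m - 1) → Bool) × Bool) → Bool)
    (hf : ∀ (u : Fin (m - 1) → Bool) (v : Bool),
      Ψ (PT u v) = vecMulVec (ebasis (f (u, v))) (star (ebasis (f (u, v))))) :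
    ∃ (g : Fin (m - 1) → Bool → Bool) (gt : Bool → Bool) (h : Bool → Bool),
      ∀ (u : Fin (m - 1) → Bool) (v : Bool),
        f (u, v) = h (xor (decide (∀ i, g i (u i) = true)) (gt v)) := by
  let φ : Matrix (Fin 2) (Fin 2) ℂ →ₗ[ℝ] ℝ :=
    Complex.reLm ∘ₗ Matrix.entryLinearMap ℝ ℂ 1 1 ∘ₗ Ψ.restrictScalars ℝ
  have hφ (A) : φ A = (Ψ A 1 1).re := rfl
  have hpos (A) (hA : A.PosSemidef) : 0 ≤ φ A := (diag_re_mem_Icc (hΨpos A hA)).1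
  have hle (A) (hA : A.PosSemidef) : φ A ≤ A.trace.re := by
    rw [← hΨtr A]
    exact (diag_re_mem_Icc (hΨpos A hA)).2
  set a : Bool → ℝ := fun v => φ (rt v)
  set b : Bool → ℝ := fun v => φ (pauliX * rt v * pauliX)
  set p : (Fin (m - 1) → Bool) → ℝ := fun u => ∏ i, (r i (u i) 1 1).re with hp
  have hX (v) := posSemidef_pauliX_conj (hrt v).1
  have ha0 (v) : 0 ≤ a v := hpos _ (hrt v).1
  have ha1 (v) : a v ≤ 1 := by simpa [(hrt v).2] using hle _ (hrt v).1
  have hb0 (v) : 0 ≤ b v := hpos _ (hX v)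
  have hb1 (v) : b v ≤ 1 := by simpa [trace_pauliX_conj, (hrt v).2] using hle _ (hX v)
  have hr0 (i c) : 0 ≤ (r i c 1 1).re := (diag_re_mem_Icc (hr i c).1).1
  have hr1 (i c) : (r i c 1 1).re ≤ 1 := by
    simpa [(hr i c).2] using (diag_re_mem_Icc (hr i c).1).2
  have hp0 (u) : 0 ≤ p u := Finset.prod_nonneg fun i _ => hr0 i _
  have hp1 (u) : p u ≤ 1 := Finset.prod_le_one (fun i _ => hr0 i _) fun i _ => hr1 i _
  have hmix (u v) : (1 - p u) * a v + p u * b v = if f (u, v) then 1 else 0 := by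
    have hPT' : PT u v = (1 - p u) • rt v + p u • (pauliX * rt v * pauliX) := by
      ext j k
      rw [hPT, sum_toffoli_conj hT (fun i => hr i (u i)) (hρ u v)]
    have h := hφ (PT u v)
    rw [hf u v, hPT', map_add, map_smul, map_smul] at h
    refine h.trans ?_
    cases f (u, v) <;> simp [vecMulVec_apply, ebasis]
  by_cases hconst : ∀ u u' v, f (u, v) = f (u', v)
  · refine ⟨fun _ _ => true, fun v => !f (fun _ => true, v), id, fun u v => ?_⟩
    simpa using hconst u _ v
  push Not at hconst
  obtain ⟨u₀, u₁, w, hne⟩ := hconst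
  obtain ⟨u₀, u₁, hf₀, hf₁⟩ : ∃ u₀ u₁, f (u₀, w) = false ∧ f (u₁, w) = true := by
    cases h₀ : f (u₀, w) <;> cases h₁ : f (u₁, w)
    · exact absurd (h₀.trans h₁.symm) hne
    · exact ⟨u₀, u₁, h₀, h₁⟩
    · exact ⟨u₁, u₀, h₁, h₀⟩
    · exact absurd (h₀.trans h₁.symm) hne
  have hab : a w ≠ b w := by
    intro h
    have h₀ := hmix u₀ w
    have h₁ := hmix u₁ w
    simp only [hf₀, hf₁, h] at h₀ h₁
    norm_num at h₀ h₁
    linarith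
  have hp01 (u) : p u = 0 ∨ p u = 1 := by
    by_contra! h
    have hlt0 : 0 < p u := lt_of_le_of_ne (hp0 u) (Ne.symm h.1)
    have hlt1 : 0 < 1 - p u := sub_pos.2 (lt_of_le_of_ne (hp1 u) h.2)
    have hu := hmix u w
    apply hab
    split_ifs at hu
    · have h1 := mul_nonneg hlt1.le (sub_nonneg.2 (ha1 w))
      have h2 := mul_nonneg hlt0.le (sub_nonneg.2 (hb1 w))
      have h3 : (1 - p u) * (1 - a w) = 0 := by linarith
      have h4 : p u * (1 - b w) = 0 := by linarith
      have h5 := (mul_eq_zero.1 h3).resolve_left hlt1.ne'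
      have h6 := (mul_eq_zero.1 h4).resolve_left hlt0.ne'
      linarith
    · have h1 := mul_nonneg hlt1.le (ha0 w)
      have h2 := mul_nonneg hlt0.le (hb0 w)
      have h3 : (1 - p u) * a w = 0 := by linarith
      have h4 : p u * b w = 0 := by linarith
      rw [(mul_eq_zero.1 h3).resolve_left hlt1.ne', (mul_eq_zero.1 h4).resolve_left hlt0.ne']
  have hsum (v) : a v + b v = 1 := by
    have h₀ := hmix u₀ w
    have h₁ := hmix u₁ w
    simp only [hf₀, hf₁] at h₀ h₁
    rcases hp01 u₀ with h | h <;> rcases hp01 u₁ with h' | h' <;>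
      simp only [h, h'] at h₀ h₁ <;> norm_num at h₀ h₁
    · linarith
    · exact effect_add_flip φ hpos hle (hrt w).1 (hrt w).2 h₀ h₁ (hrt v).1 (hrt v).2
    · refine effect_add_flip φ hpos hle (hX w) ?_ h₀ ?_ (hrt v).1 (hrt v).2
      · rw [trace_pauliX_conj, (hrt w).2]
      · rwa [pauliX_conj_conj]
    · linarith
  refine ⟨fun i c => decide ((r i c 1 1).re ≠ 0), fun v => decide (a v = 1), id, fun u v => ?_⟩
  have hg : (∀ i, decide ((r i (u i) 1 1).re ≠ 0) = true) ↔ p u ≠ 0 := by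
    simp [hp, Finset.prod_ne_zero_iff]
  have huv := hmix u v
  have hv := hsum v
  simp only [hg, id]
  rcases hp01 u with h | h <;> simp only [h] at huv ⊢ <;> cases hfv : f (u, v) <;>
    simp only [hfv] at huv <;> norm_num at huv ⊢ <;> linarith
end

section
/- (Theorem 4, universality of the one-qubit model.) For every n and every Boolean function f : (Fin n → Bool) → Bool, there exist k : ℕ, 2×2 unitary matrices U₀, U₁, …, U_k over ℂ, and indices i₁, …, i_k ∈ Fin n, such that for every input x : Fin n → Bool there is a complex number c_x with |c_x| = 1 and U_k · X^{x(i_k)} · U_{k−1} ⋯ U₁ · X^{x(i₁)} · U₀ · e₀ = c_x · e_{f(x)}, where e_false = (1,0)ᵀ and e_true = (0,1)ᵀ are the standard basis vectors of ℂ². -/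
open Matrix

/-- The Pauli X matrix raised to a Boolean power: `X` if `b` is true, identity otherwise. -/
noncomputable def Xpow (b : Bool) : Matrix (Fin 2) (Fin 2) ℂ :=
  if b then !![0, 1; 1, 0] else 1

/-- The matrix-valued functions of the input realised by one-qubit programs. -/
def oneQubit (n : ℕ) : Submonoid ((Fin n → Bool) → Matrix (Fin 2) (Fin 2) ℂ) :=
  Submonoid.closure
    ({F | ∃ U ∈ unitaryGroup (Fin 2) ℂ, F = fun _ => U} ∪
      Set.range fun i x => Xpow (x i))

/-- A Boolean function `g` such that `X ^ g x` is realised up to an input-dependent phase. -/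
def PhaseComputable {n : ℕ} (g : (Fin n → Bool) → Bool) : Prop :=
  ∃ F ∈ oneQubit n, ∀ x, ∃ c : ℂ, ‖c‖ = 1 ∧ F x = c • Xpow (g x)

lemma const_mem_oneQubit {n : ℕ} {U : Matrix (Fin 2) (Fin 2) ℂ}
    (hU : U ∈ unitaryGroup (Fin 2) ℂ) : (fun _ => U) ∈ oneQubit n :=
  Submonoid.subset_closure (Or.inl ⟨U, hU, rfl⟩)

lemma Xpow_mul_Xpow (a b : Bool) : Xpow a * Xpow b = Xpow (xor a b) := by
  cases a <;> cases b <;> simp [Xpow, one_fin_two]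

lemma Xpow_mem_unitaryGroup (b : Bool) : Xpow b ∈ unitaryGroup (Fin 2) ℂ := by
  have hstar : star (Xpow b) = Xpow b := by
    cases b
    · simp [Xpow]
    · ext i j; fin_cases i <;> fin_cases j <;> simp [Xpow]
  rw [mem_unitaryGroup_iff, hstar, Xpow_mul_Xpow]
  simp [Xpow]

lemma Xpow_mulVec_ebasis_false (b : Bool) : Xpow b *ᵥ ebasis false = ebasis b := by
  cases b <;> ext i <;> fin_cases i <;>
    simp [Xpow, ebasis, mulVec, dotProduct, one_fin_two]

/-- Every function in `oneQubit n` comes from a list of program steps, the last step first. -/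
lemma exists_list_of_mem_oneQubit {n : ℕ} {F : (Fin n → Bool) → Matrix (Fin 2) (Fin 2) ℂ}
    (hF : F ∈ oneQubit n) :
    ∃ (l : List (Matrix (Fin 2) (Fin 2) ℂ × Fin n)) (V : Matrix (Fin 2) (Fin 2) ℂ),
      V ∈ unitaryGroup (Fin 2) ℂ ∧ (∀ p ∈ l, p.1 ∈ unitaryGroup (Fin 2) ℂ) ∧
      ∀ x, F x = (l.map fun p => p.1 * Xpow (x p.2)).prod * V := by
  induction hF using Submonoid.closure_induction with
  | mem F hF =>
    rcases hF with ⟨U, hU, rfl⟩ | ⟨i, rfl⟩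
    · exact ⟨[], U, hU, by simp, by simp⟩
    · exact ⟨[(1, i)], 1, one_mem _, by simp [one_mem], by simp⟩
  | one => exact ⟨[], 1, one_mem _, by simp, by simp⟩
  | mul F G _ _ ihF ihG =>
    obtain ⟨l, V, hV, hl, hFl⟩ := ihF
    obtain ⟨m, W, hW, hm, hGm⟩ := ihG
    cases m with
    | nil => exact ⟨l, V * W, mul_mem hV hW, hl, fun x => by simp [hFl, hGm, mul_assoc]⟩
    | cons p m =>
      refine ⟨l ++ (V * p.1, p.2) :: m, W, hW, fun q hq => ?_,
        fun x => by simp [hFl, hGm, mul_assoc]⟩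
      rcases List.mem_append.1 hq with hq | hq
      · exact hl q hq
      · rcases List.mem_cons.1 hq with rfl | hq
        · exact mul_mem hV (hm p List.mem_cons_self)
        · exact hm q (List.mem_cons_of_mem _ hq)

namespace PhaseComputable

variable {n : ℕ} {g h : (Fin n → Bool) → Bool}

lemma const (b : Bool) : PhaseComputable fun _ : Fin n → Bool => b :=
  ⟨_, const_mem_oneQubit (Xpow_mem_unitaryGroup b), fun _ => ⟨1, by simp, by simp⟩⟩

lemma input (i : Fin n) : PhaseComputable fun x => x i :=
  ⟨_, Submonoid.subset_closure (Or.inr ⟨i, rfl⟩), fun _ => ⟨1, by simp, by simp⟩⟩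

lemma xor (hg : PhaseComputable g) (hh : PhaseComputable h) :
    PhaseComputable fun x => Bool.xor (g x) (h x) := by
  obtain ⟨F, hF, hFg⟩ := hg
  obtain ⟨G, hG, hGh⟩ := hh
  refine ⟨F * G, mul_mem hF hG, fun x => ?_⟩
  obtain ⟨c, hc, hcx⟩ := hFg x
  obtain ⟨d, hd, hdx⟩ := hGh x
  refine ⟨c * d, by simp [hc, hd], ?_⟩
  simp [hcx, hdx, smul_smul, ← Xpow_mul_Xpow, mul_comm]

lemma not (hg : PhaseComputable g) : PhaseComputable fun x => !g x := by
  simpa using hg.xor (const true)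

/-- The group commutator of half turns about two axes at angle `π / 4` is again a half turn. -/
lemma exists_commutator_eq_Xpow_and :
    ∃ C ∈ unitaryGroup (Fin 2) ℂ, ∃ D ∈ unitaryGroup (Fin 2) ℂ, ∀ a b : Bool,
      ∃ c : ℂ, ‖c‖ = 1 ∧
        D * (Xpow a * (C * Xpow b * star C)) * (Xpow a * (C * Xpow b * star C)) * star D =
          c • Xpow (a && b) := by
  obtain ⟨w, hw⟩ := IsAlgClosed.exists_pow_nat_eq Complex.I (n := 2) (by norm_num)
  have hnorm : ‖w‖ = 1 := by
    have : ‖w‖ ^ 2 = 1 := by rw [← norm_pow, hw, Complex.norm_I]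
    exact (pow_eq_one_iff_of_nonneg (norm_nonneg w) two_ne_zero).1 this
  have hww : w * star w = 1 := by
    rw [Complex.star_def, Complex.mul_conj, Complex.normSq_eq_norm_sq, hnorm]; simp
  obtain ⟨p, hp⟩ : ∃ p : ℂ, 2 * (p * star p) = 1 := by
    refine ⟨(1 + Complex.I) / 2, ?_⟩
    simp only [Complex.star_def, map_div₀, map_add, map_one, Complex.conj_I, map_ofNat]
    grind [Complex.I_sq]
  have hstar (a b c d : ℂ) : star !![a, b; c, d] = !![star a, star c; star b, star d] := by
    ext i j; fin_cases i <;> fin_cases j <;> rfl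
  have hone : (1 : Matrix (Fin 2) (Fin 2) ℂ) = !![1, 0; 0, 1] := one_fin_two
  have hext {a b c d a' b' c' d' : ℂ} (ha : a = a') (hb : b = b') (hc : c = c') (hd : d = d') :
      !![a, b; c, d] = !![a', b'; c', d'] := by rw [ha, hb, hc, hd]
  refine ⟨!![1, 0; 0, w], ?_, !![p, p; p, -p], ?_, fun a b =>
    ⟨if a && b then Complex.I else 1, by split <;> simp, ?_⟩⟩
  · rw [mem_unitaryGroup_iff, hstar, hone, mul_fin_two]
    simp only [star_one, star_zero, hww, mul_zero, mul_one, zero_mul, add_zero, zero_add]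
  · rw [mem_unitaryGroup_iff, hstar, hone, mul_fin_two, star_neg]
    refine hext ?_ ?_ ?_ ?_ <;> grind
  · rw [hstar, hstar, star_neg, star_one, star_zero]
    clear hstar
    generalize star w = v at hww ⊢
    generalize star p = q at hp ⊢
    cases a <;> cases b <;>
      simp only [Xpow, hone, mul_fin_two, Bool.and_false, Bool.and_true, Bool.false_eq_true,
        if_true, if_false, smul_of, smul_cons, smul_empty, smul_eq_mul] <;>
      refine hext ?_ ?_ ?_ ?_ <;> grind [Complex.I_sq]

lemma and (hg : PhaseComputable g) (hh : PhaseComputable h) :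
    PhaseComputable fun x => g x && h x := by
  obtain ⟨F, hF, hFg⟩ := hg
  obtain ⟨G, hG, hGh⟩ := hh
  obtain ⟨C, hC, D, hD, hCD⟩ := exists_commutator_eq_Xpow_and
  have hK : F * ((fun _ => C) * G * fun _ => star C) ∈ oneQubit n :=
    mul_mem hF (mul_mem (mul_mem (const_mem_oneQubit hC) hG)
      (const_mem_oneQubit (Unitary.star_mem hC)))
  refine ⟨_, mul_mem (mul_mem (mul_mem (const_mem_oneQubit hD) hK) hK)
    (const_mem_oneQubit (Unitary.star_mem hD)), fun x => ?_⟩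
  obtain ⟨c, hc, hcx⟩ := hFg x
  obtain ⟨d, hd, hdx⟩ := hGh x
  obtain ⟨e, he, hex⟩ := hCD (g x) (h x)
  refine ⟨(c * d) ^ 2 * e, by simp [hc, hd, he], ?_⟩
  rw [mul_smul, ← hex]
  simp only [Pi.mul_apply, hcx, hdx, smul_mul_assoc, mul_smul_comm, smul_smul]
  congr 1
  ring

lemma or (hg : PhaseComputable g) (hh : PhaseComputable h) :
    PhaseComputable fun x => g x || h x := by
  simpa using (hg.not.and hh.not).not

end PhaseComputable

lemma phaseComputable_decide_eq {n : ℕ} (a : Fin n → Bool) :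
    PhaseComputable fun x => decide (x = a) := by
  have key (s : Finset (Fin n)) : PhaseComputable fun x => decide (∀ i ∈ s, x i = a i) := by
    induction s using Finset.induction_on with
    | empty => simpa using PhaseComputable.const true
    | insert i s _ ih =>
      have hi : PhaseComputable fun x => decide (x i = a i) := by
        cases a i
        · simpa using (PhaseComputable.input i).not
        · simpa using PhaseComputable.input i
      simpa [Finset.forall_mem_insert] using hi.and ih
  simpa [funext_iff] using key Finset.univ

lemma phaseComputable_all {n : ℕ} (f : (Fin n → Bool) → Bool) : PhaseComputable f := by
  have key (s : Finset (Fin n → Bool)) : PhaseComputable fun x => decide (x ∈ s) := by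
    induction s using Finset.induction_on with
    | empty => simpa using PhaseComputable.const false
    | insert a s _ ih => simpa using (phaseComputable_decide_eq a).or ih
  simpa using key (Finset.univ.filter fun x => f x = true)

/-- Theorem 4: the one-qubit model can compute every Boolean function.  There is a
one-qubit program `U_k X^{x i_k} U_{k-1} ⋯ U_1 X^{x i_1} U_0` whose action on `|0⟩` is,
up to a global phase, `|f x⟩`. -/
theorem one_qubit_model_universal (n : ℕ) (f : (Fin n → Bool) → Bool) :
    ∃ (k : ℕ) (U : Fin (k + 1) → Matrix (Fin 2) (Fin 2) ℂ) (idx : Fin k → Fin n),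
      (∀ j, U j ∈ Matrix.unitaryGroup (Fin 2) ℂ) ∧
      ∀ x : Fin n → Bool, ∃ c : ℂ, ‖c‖ = 1 ∧
        ((List.ofFn fun j : Fin k => U j.succ * Xpow (x (idx j))).reverse.prod * U 0) *ᵥ
            ebasis false
          = c • ebasis (f x) := by
  obtain ⟨F, hF, hc⟩ := phaseComputable_all f
  obtain ⟨l, V, hV, hl, hFl⟩ := exists_list_of_mem_oneQubit hF
  refine ⟨l.reverse.length, Fin.cons V fun j => (l.reverse.get j).1,
    fun j => (l.reverse.get j).2, ?_, fun x => ?_⟩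
  · refine Fin.cases hV fun j => ?_
    exact hl _ (List.mem_reverse.1 (l.reverse.get_mem j))
  · obtain ⟨c, hc1, hcx⟩ := hc x
    refine ⟨c, hc1, ?_⟩
    have hofFn : (List.ofFn fun j : Fin l.reverse.length =>
        (l.reverse.get j).1 * Xpow (x (l.reverse.get j).2)) =
        l.reverse.map fun p => p.1 * Xpow (x p.2) := by
      conv_rhs => rw [← List.ofFn_get l.reverse, List.map_ofFn]
      rfl
    simp only [Fin.cons_succ, Fin.cons_zero]
    rw [hofFn, List.map_reverse, List.reverse_reverse, ← hFl, hcx, smul_mulVec,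
      Xpow_mulVec_ebasis_false]
end

section
/- (Theorem 4, quantitative form.) Let n : ℕ and let BFormula n be the inductive type of Boolean formulas over variables indexed by Fin n, with constructors var (i : Fin n), not φ, and (φ, ψ), or (φ, ψ); define eval : BFormula n → (Fin n → Bool) → Bool in the obvious way, and define depth by depth(var i) = 0, depth(not φ) = depth φ, depth(and φ ψ) = depth(or φ ψ) = 1 + max(depth φ, depth ψ). Then for every φ : BFormula n of depth d there exist k ≤ 4^d, 2×2 unitary matrices U₀, …, U_k over ℂ, and indices i₁, …, i_k ∈ Fin n, such that for every x : Fin n → Bool there is a complex number c_x with |c_x| = 1 and U_k · X^{x(i_k)} · U_{k−1} ⋯ U₁ · X^{x(i₁)} · U₀ = c_x · X^{eval φ x}. -/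
open Matrix

/-- Boolean formulas over variables indexed by `Fin n`. -/
inductive BFormula (n : ℕ) : Type
  | var : Fin n → BFormula n
  | not : BFormula n → BFormula n
  | and : BFormula n → BFormula n → BFormula n
  | or : BFormula n → BFormula n → BFormula n

/-- Evaluation of a Boolean formula on an assignment. -/
def BFormula.eval {n : ℕ} : BFormula n → (Fin n → Bool) → Bool
  | var i, x => x i
  | not φ, x => !(φ.eval x)
  | and φ ψ, x => φ.eval x && ψ.eval x
  | or φ ψ, x => φ.eval x || ψ.eval x

/-- Depth of a Boolean formula: the number of `and`/`or` gates on the longest path. -/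
def BFormula.depth {n : ℕ} : BFormula n → ℕ
  | var _ => 0
  | not φ => φ.depth
  | and φ ψ => 1 + max φ.depth ψ.depth
  | or φ ψ => 1 + max φ.depth ψ.depth

/-- `HasProgram k F` says that some one-qubit program of length `k` acts on each input `x`
as the matrix `F x`. -/
inductive HasProgram {n : ℕ} : ℕ → ((Fin n → Bool) → Matrix (Fin 2) (Fin 2) ℂ) → Prop
  | unitary (U : Matrix (Fin 2) (Fin 2) ℂ) (hU : U ∈ Matrix.unitaryGroup (Fin 2) ℂ) :
      HasProgram 0 fun _ => U
  | query {k : ℕ} {F : (Fin n → Bool) → Matrix (Fin 2) (Fin 2) ℂ}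
      (U : Matrix (Fin 2) (Fin 2) ℂ) (hU : U ∈ Matrix.unitaryGroup (Fin 2) ℂ) (i : Fin n)
      (hF : HasProgram k F) : HasProgram (k + 1) fun x => U * Xpow (x i) * F x

namespace HasProgram

variable {n k l : ℕ} {F G : (Fin n → Bool) → Matrix (Fin 2) (Fin 2) ℂ}

theorem unitary_mul {V : Matrix (Fin 2) (Fin 2) ℂ} (hV : V ∈ Matrix.unitaryGroup (Fin 2) ℂ)
    (hF : HasProgram k F) : HasProgram k fun x => V * F x := by
  cases hF with
  | unitary U hU => exact .unitary _ (mul_mem hV hU)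
  | query U hU i hF =>
    simpa only [mul_assoc] using HasProgram.query (V * U) (mul_mem hV hU) i hF

theorem mul (hF : HasProgram k F) (hG : HasProgram l G) :
    HasProgram (k + l) fun x => F x * G x := by
  induction hF with
  | unitary U hU => simpa only [zero_add] using hG.unitary_mul hU
  | query U hU i _ ih =>
    simpa only [mul_assoc, Nat.add_right_comm] using HasProgram.query U hU i ih

theorem exists_ofFn (hF : HasProgram k F) :
    ∃ (U : Fin (k + 1) → Matrix (Fin 2) (Fin 2) ℂ) (idx : Fin k → Fin n),
      (∀ j, U j ∈ Matrix.unitaryGroup (Fin 2) ℂ) ∧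
      ∀ x : Fin n → Bool,
        (List.ofFn fun j : Fin k => U j.succ * Xpow (x (idx j))).reverse.prod * U 0 = F x := by
  induction hF with
  | unitary U hU => exact ⟨fun _ => U, Fin.elim0, fun _ => hU, fun x => by simp⟩
  | @query k F V hV i _ ih =>
    obtain ⟨U, idx, hU, h⟩ := ih
    refine ⟨Fin.snoc (α := fun _ => Matrix (Fin 2) (Fin 2) ℂ) U V,
      Fin.snoc (α := fun _ => Fin n) idx i, fun j => ?_, fun x => ?_⟩
    · induction j using Fin.lastCases with
      | last => simpa using hV
      | cast j => simpa using hU j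
    · have h0 : Fin.snoc (α := fun _ => Matrix (Fin 2) (Fin 2) ℂ) U V 0 = U 0 := by
        rw [← Fin.castSucc_zero, Fin.snoc_castSucc]
      rw [List.ofFn_succ', h0]
      simp only [Fin.succ_castSucc, Fin.snoc_castSucc, Fin.succ_last, Fin.snoc_last,
        List.concat_eq_append, List.reverse_append, List.reverse_singleton,
        List.prod_append, List.prod_singleton, mul_assoc, ← h x]

end HasProgram

theorem Xpow_true_mem_unitaryGroup : Xpow true ∈ Matrix.unitaryGroup (Fin 2) ℂ := by
  rw [Matrix.mem_unitaryGroup_iff]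
  ext i j
  fin_cases i <;> fin_cases j <;> simp [Xpow, Matrix.mul_apply, Fin.sum_univ_two]

theorem Xpow_true_mul (b : Bool) : Xpow true * Xpow b = Xpow (!b) := by
  cases b <;> simp [Xpow, Matrix.one_fin_two]

/-- The conjunction of two bits is computed, up to a phase, by querying each of them twice. -/
theorem exists_unitary_Xpow_and :
    ∃ V ∈ Matrix.unitaryGroup (Fin 2) ℂ, ∃ D ∈ Matrix.unitaryGroup (Fin 2) ℂ,
      ∀ a b : Bool, ∃ c : ℂ, ‖c‖ = 1 ∧
        V * (Xpow a * (D * (Xpow b * (star D * (Xpow a * (D * (Xpow b * (star D * star V))))))))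
          = c • Xpow (a && b) := by
  obtain ⟨w, hw, hw'⟩ : ∃ w : ℂ, w ^ 2 = Complex.I ∧ w * (starRingEnd ℂ) w = 1 := by
    refine ⟨Complex.exp ((Real.pi / 4 : ℝ) * Complex.I), ?_, ?_⟩
    · rw [← Complex.exp_nat_mul]
      refine Eq.trans (congrArg Complex.exp ?_) Complex.exp_pi_div_two_mul_I
      push_cast
      ring
    · rw [Complex.mul_conj, Complex.normSq_eq_norm_sq, Complex.norm_exp_ofReal_mul_I]
      simp
  have hI : Complex.I ^ 2 = -1 := Complex.I_sq
  have h2 : (starRingEnd ℂ) 2 = 2 := map_ofNat _ 2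
  have hV : !![(1 + Complex.I) / 2, (1 + Complex.I) / 2;
      (1 + Complex.I) / 2, -((1 + Complex.I) / 2)] ∈ Matrix.unitaryGroup (Fin 2) ℂ := by
    rw [Matrix.mem_unitaryGroup_iff]
    ext i j
    fin_cases i <;> fin_cases j <;>
      simp [Matrix.mul_apply, Fin.sum_univ_two, Matrix.star_apply] <;> grind
  have hD : !![1, 0; 0, w] ∈ Matrix.unitaryGroup (Fin 2) ℂ := by
    rw [Matrix.mem_unitaryGroup_iff]
    ext i j
    fin_cases i <;> fin_cases j <;>
      simp [Matrix.mul_apply, Fin.sum_univ_two, Matrix.star_apply, hw']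
  refine ⟨_, hV, _, hD, fun a b => ?_⟩
  have hX : Xpow true * Xpow true = 1 := Xpow_true_mul true
  have hX' : ∀ M : Matrix (Fin 2) (Fin 2) ℂ, Xpow true * (Xpow true * M) = M := fun M => by
    rw [← mul_assoc, hX, one_mul]
  have hVV := Matrix.mem_unitaryGroup_iff.1 hV
  have hDD : ∀ M : Matrix (Fin 2) (Fin 2) ℂ, !![1, 0; 0, w] * (star !![1, 0; 0, w] * M) = M :=
    fun M => by rw [← mul_assoc, Matrix.mem_unitaryGroup_iff.1 hD, one_mul]
  have hDD' : ∀ M : Matrix (Fin 2) (Fin 2) ℂ, star !![1, 0; 0, w] * (!![1, 0; 0, w] * M) = M :=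
    fun M => by rw [← mul_assoc, Matrix.mem_unitaryGroup_iff'.1 hD, one_mul]
  have hf : Xpow false = 1 := rfl
  cases a <;> cases b
  · exact ⟨1, by simp, by simp only [hf, one_mul, hDD, hVV]; simp [hf]⟩
  · exact ⟨1, by simp, by simp only [hf, one_mul, hDD, hDD', hX', hVV]; simp [hf]⟩
  · exact ⟨1, by simp, by simp only [hf, one_mul, hDD, hX', hVV]; simp [hf]⟩
  · refine ⟨Complex.I, by simp, ?_⟩
    have hstar (p q r t : ℂ) : star !![p, q; r, t] = !![star p, star r; star q, star t] := by
      ext i j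
      fin_cases i <;> fin_cases j <;> rfl
    have hw2 : (starRingEnd ℂ) w ^ 2 = -Complex.I := by rw [← map_pow, hw, Complex.conj_I]
    simp only [hstar, Xpow, Bool.and_true, if_true, Matrix.mul_fin_two, Matrix.smul_of]
    ext i j
    fin_cases i <;> fin_cases j <;> simp <;> grind

theorem exists_hasProgram_not {n : ℕ} {f : (Fin n → Bool) → Bool} {N : ℕ}
    (hf : ∃ k ≤ N, ∃ c : (Fin n → Bool) → ℂ, (∀ x, ‖c x‖ = 1) ∧
      HasProgram k fun x => c x • Xpow (f x)) :
    ∃ k ≤ N, ∃ c : (Fin n → Bool) → ℂ, (∀ x, ‖c x‖ = 1) ∧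
      HasProgram k fun x => c x • Xpow (!f x) := by
  obtain ⟨k, hk, c, hc, h⟩ := hf
  refine ⟨k, hk, c, hc, ?_⟩
  simpa only [Matrix.mul_smul, Xpow_true_mul] using h.unitary_mul Xpow_true_mem_unitaryGroup

theorem exists_hasProgram_and {n : ℕ} {f g : (Fin n → Bool) → Bool} {N M : ℕ}
    (hf : ∃ k ≤ N, ∃ c : (Fin n → Bool) → ℂ, (∀ x, ‖c x‖ = 1) ∧
      HasProgram k fun x => c x • Xpow (f x))
    (hg : ∃ k ≤ M, ∃ c : (Fin n → Bool) → ℂ, (∀ x, ‖c x‖ = 1) ∧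
      HasProgram k fun x => c x • Xpow (g x)) :
    ∃ k ≤ 2 * (N + M), ∃ c : (Fin n → Bool) → ℂ, (∀ x, ‖c x‖ = 1) ∧
      HasProgram k fun x => c x • Xpow (f x && g x) := by
  obtain ⟨k, hk, c, hc, hF⟩ := hf
  obtain ⟨l, hl, d, hd, hG⟩ := hg
  obtain ⟨V, hV, D, hD, h⟩ := exists_unitary_Xpow_and
  have hV' := Unitary.star_mem hV
  have hD' := Unitary.star_mem hD
  choose e he h using h
  refine ⟨k + (l + (k + (l + 0))), by omega,
    fun x => c x * d x * c x * d x * e (f x) (g x), fun x => by simp [hc, hd, he], ?_⟩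
  convert (hF.mul ((hG.mul ((hF.mul ((hG.mul (HasProgram.unitary _
    (mul_mem hD' hV'))).unitary_mul hD)).unitary_mul hD')).unitary_mul hD)).unitary_mul hV
    using 2 with x
  rw [mul_smul, ← h]
  simp only [Matrix.mul_smul, Matrix.smul_mul, smul_smul, mul_assoc]
  congr 1
  ring

theorem BFormula.exists_hasProgram {n : ℕ} (φ : BFormula n) :
    ∃ k ≤ 4 ^ φ.depth, ∃ c : (Fin n → Bool) → ℂ, (∀ x, ‖c x‖ = 1) ∧
      HasProgram k fun x => c x • Xpow (φ.eval x) := by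
  have bound (a b : ℕ) : 2 * (4 ^ a + 4 ^ b) ≤ 4 ^ (1 + max a b) := by
    have ha : 4 ^ a ≤ 4 ^ max a b := Nat.pow_le_pow_right (by norm_num) (le_max_left a b)
    have hb : 4 ^ b ≤ 4 ^ max a b := Nat.pow_le_pow_right (by norm_num) (le_max_right a b)
    rw [pow_add]
    omega
  induction φ with
  | var i =>
    refine ⟨1, by simp [depth], fun _ => 1, by simp, ?_⟩
    simpa [eval] using HasProgram.query 1 (one_mem _) i (HasProgram.unitary 1 (one_mem _))
  | not φ ih => exact exists_hasProgram_not ih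
  | and φ ψ ihφ ihψ =>
    obtain ⟨k, hk, h⟩ := exists_hasProgram_and ihφ ihψ
    exact ⟨k, hk.trans (bound _ _), h⟩
  | or φ ψ ihφ ihψ =>
    obtain ⟨k, hk, h⟩ := exists_hasProgram_not
      (exists_hasProgram_and (exists_hasProgram_not ihφ) (exists_hasProgram_not ihψ))
    refine ⟨k, hk.trans (bound _ _), ?_⟩
    simpa [eval] using h

/-- Theorem 4, quantitative form: a Boolean formula of depth `d` is computed by a
one-qubit program of length at most `4^d`, in the sense that the program's product equals
`X^{eval φ x}` up to a global phase. -/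
theorem one_qubit_program_of_formula (n : ℕ) (φ : BFormula n) :
    ∃ k : ℕ, k ≤ 4 ^ φ.depth ∧
      ∃ (U : Fin (k + 1) → Matrix (Fin 2) (Fin 2) ℂ) (idx : Fin k → Fin n),
        (∀ j, U j ∈ Matrix.unitaryGroup (Fin 2) ℂ) ∧
        ∀ x : Fin n → Bool, ∃ c : ℂ, ‖c‖ = 1 ∧
          (List.ofFn fun j : Fin k => U j.succ * Xpow (x (idx j))).reverse.prod * U 0
            = c • Xpow (φ.eval x) := by
  obtain ⟨k, hk, c, hc, h⟩ := φ.exists_hasProgram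
  obtain ⟨U, idx, hU, hprod⟩ := h.exists_ofFn
  exact ⟨k, hk, U, idx, hU, fun x => ⟨c x, hc x, hprod x⟩⟩
end

section
/- (AND gadget of the one-qubit model.) Let V = (1/√2)(X + Y). Then for all Booleans a, b: V · X^a · H^b · X^a · H^b · V = c · X^{a ∧ b}, where c = −i if a ∧ b is true and c = 1 otherwise. In particular V · X · H · X · H · V = −i·X. -/
open Matrix

/-- The Pauli Y matrix. -/
noncomputable def PauliY : Matrix (Fin 2) (Fin 2) ℂ := !![0, -Complex.I; Complex.I, 0]

/-- The Hadamard matrix. -/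
noncomputable def Hadamard : Matrix (Fin 2) (Fin 2) ℂ :=
  ((Real.sqrt 2 : ℂ))⁻¹ • !![1, 1; 1, -1]

/-- A matrix raised to a Boolean power: the matrix if `b` is true, identity otherwise. -/
noncomputable def bpow (M : Matrix (Fin 2) (Fin 2) ℂ) (b : Bool) :
    Matrix (Fin 2) (Fin 2) ℂ := if b then M else 1

theorem PauliX_mul_self : PauliX * PauliX = 1 := by
  simp [PauliX, Matrix.one_fin_two]

theorem inv_sqrt_two_mul_self :
    ((Real.sqrt 2 : ℂ))⁻¹ * ((Real.sqrt 2 : ℂ))⁻¹ = 2⁻¹ := by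
  rw [← mul_inv, ← Complex.ofReal_mul, Real.mul_self_sqrt (by norm_num)]
  norm_num

theorem Hadamard_mul_self : Hadamard * Hadamard = 1 := by
  rw [Hadamard, smul_mul_smul_comm, inv_sqrt_two_mul_self]
  ext i j
  fin_cases i <;> fin_cases j <;> norm_num [Matrix.mul_apply]

theorem Hadamard_mul_PauliX_mul_Hadamard :
    Hadamard * PauliX * Hadamard = !![1, 0; 0, -1] := by
  rw [Hadamard, smul_mul_assoc, smul_mul_smul_comm, inv_sqrt_two_mul_self]
  ext i j
  fin_cases i <;> fin_cases j <;> norm_num [PauliX, Matrix.mul_apply]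

theorem PauliX_add_PauliY_normalized_mul_self :
    ((Real.sqrt 2 : ℂ))⁻¹ • (PauliX + PauliY) *
      (((Real.sqrt 2 : ℂ))⁻¹ • (PauliX + PauliY)) = 1 := by
  rw [smul_mul_smul_comm, inv_sqrt_two_mul_self]
  ext i j
  fin_cases i <;> fin_cases j <;> simp [PauliX, PauliY] <;>
    ring_nf <;> norm_num

theorem and_gadget_true_true :
    ((Real.sqrt 2 : ℂ))⁻¹ • (PauliX + PauliY) * PauliX * Hadamard * PauliX * Hadamard *
        (((Real.sqrt 2 : ℂ))⁻¹ • (PauliX + PauliY))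
      = (-Complex.I) • PauliX := by
  have h : ∀ V : Matrix (Fin 2) (Fin 2) ℂ,
      V * PauliX * Hadamard * PauliX * Hadamard * V =
        V * PauliX * (Hadamard * PauliX * Hadamard) * V := fun V => by
    simp only [mul_assoc]
  rw [h, Hadamard_mul_PauliX_mul_Hadamard, smul_mul_assoc, smul_mul_assoc,
    smul_mul_smul_comm, inv_sqrt_two_mul_self]
  ext i j
  fin_cases i <;> fin_cases j <;> simp [PauliX, PauliY] <;>
    ring_nf <;> simp <;> ring

/-- The AND gadget of the one-qubit model: with `V = (X + Y)/√2`,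
`V X^a H^b X^a H^b V = c • X^{a ∧ b}` with `c = -i` when `a ∧ b` holds and `c = 1`
otherwise; in particular `V X H X H V = -i • X`. -/
theorem one_qubit_and_gadget :
    (∀ a b : Bool,
      ((Real.sqrt 2 : ℂ))⁻¹ • (PauliX + PauliY) * bpow PauliX a * bpow Hadamard b *
          bpow PauliX a * bpow Hadamard b * (((Real.sqrt 2 : ℂ))⁻¹ • (PauliX + PauliY))
        = (if a && b then -Complex.I else 1) • bpow PauliX (a && b)) ∧
    ((Real.sqrt 2 : ℂ))⁻¹ • (PauliX + PauliY) * PauliX * Hadamard * PauliX * Hadamard *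
        (((Real.sqrt 2 : ℂ))⁻¹ • (PauliX + PauliY))
      = (-Complex.I) • PauliX := by
  refine ⟨fun a b => ?_, and_gadget_true_true⟩
  cases a <;> cases b
  · simpa [bpow] using PauliX_add_PauliY_normalized_mul_self
  · simp only [bpow, Bool.false_and, Bool.false_eq_true, if_false, if_true, mul_one, one_smul]
    rw [mul_assoc _ Hadamard Hadamard, Hadamard_mul_self, mul_one,
      PauliX_add_PauliY_normalized_mul_self]
  · simp only [bpow, Bool.and_false, Bool.false_eq_true, if_false, if_true, mul_one, one_smul]
    rw [mul_assoc _ PauliX PauliX, PauliX_mul_self, mul_one,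
      PauliX_add_PauliY_normalized_mul_self]
  · simpa only [bpow, Bool.and_true, if_true] using and_gadget_true_true
end
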